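/- Let (ξ_n)_{n ≥ 0} be a sequence of real random variables, each distributed as a standard normal N(0,1). Then, almost surely, the power series ∑_{n ≥ 0} (ξ_n/√(n!)) z^n has infinite radius of convergence; that is, for almost every ω, the series ∑_{n ≥ 0} (ξ_n(ω)/√(n!)) z^n converges absolutely for every z ∈ ℂ, and hence defines an entire function of z. -/

import Mathlib

open MeasureTheory ProbabilityTheory

/-- Identically distributed variables with a finite absolute first moment are a.s. summable
against any summable sequence of weights. -/
theorem ae_summable_mul_norm_of_map_eq {Ω E : Type*} [MeasurableSpace Ω] {P : Measure Ω}
    [NormedAddCommGroup E] [MeasurableSpace E] [OpensMeasurableSpace E]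
    {X : ℕ → Ω → E} (hX : ∀ n, Measurable (X n)) {ν : Measure E}
    (hν : ∀ n, P.map (X n) = ν) (hint : ∫⁻ x, ‖x‖ₑ ∂ν ≠ ⊤)
    {w : ℕ → ℝ} (hw : Summable w) (hw0 : ∀ n, 0 ≤ w n) :
    ∀ᵐ ω ∂P, Summable fun n ↦ w n * ‖X n ω‖ := by
  have hmeas (n : ℕ) : Measurable fun ω ↦ ENNReal.ofReal (w n) * ‖X n ω‖ₑ :=
    (hX n).enorm.const_mul _
  have hfin : ∫⁻ ω, ∑' n, ENNReal.ofReal (w n) * ‖X n ω‖ₑ ∂P ≠ ⊤ := by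
    have hterm (n : ℕ) : ∫⁻ ω, ENNReal.ofReal (w n) * ‖X n ω‖ₑ ∂P
        = ENNReal.ofReal (w n) * ∫⁻ x, ‖x‖ₑ ∂ν := by
      rw [lintegral_const_mul _ (hX n).enorm, ← hν n, lintegral_map measurable_enorm (hX n)]
    rw [lintegral_tsum fun n ↦ (hmeas n).aemeasurable, tsum_congr hterm, ENNReal.tsum_mul_right]
    exact ENNReal.mul_ne_top hw.tsum_ofReal_ne_top hint
  filter_upwards [ae_lt_top (Measurable.tsum hmeas) hfin] with ω hω
  simpa [ENNReal.toReal_mul, ENNReal.toReal_ofReal, hw0] using ENNReal.summable_toReal hω.ne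

/-- A sequence that is square-summable against geometric weights `2⁻ⁿ` gives, after division by
`√(n!)`, the coefficients of an everywhere absolutely convergent power series. -/
theorem summable_norm_div_sqrt_factorial_mul_pow {a : ℕ → ℝ}
    (ha : Summable fun n ↦ (1 / 2 : ℝ) ^ n * a n ^ 2) (z : ℂ) :
    Summable fun n : ℕ =>
      ‖((a n : ℂ) / (Real.sqrt (Nat.factorial n : ℝ) : ℂ)) * z ^ n‖ := by
  refine Summable.of_nonneg_of_le (fun n ↦ norm_nonneg _) (fun n ↦ ?_)
    (ha.add (Real.summable_pow_div_factorial (2 * ‖z‖ ^ 2)))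
  have hfac : (0 : ℝ) < (Nat.factorial n : ℝ) := by positivity
  set s := Real.sqrt (Nat.factorial n : ℝ) with hs
  have hs0 : 0 < s := Real.sqrt_pos.2 hfac
  have hs2 : s ^ 2 = Nat.factorial n := Real.sq_sqrt hfac.le
  have hnorm : ‖((a n : ℂ) / (s : ℂ)) * z ^ n‖ = |a n| * (‖z‖ ^ n / s) := by
    rw [norm_mul, norm_div, norm_pow, Complex.norm_real, Complex.norm_real, Real.norm_eq_abs,
      Real.norm_of_nonneg hs0.le]
    ring
  have hexp : (2 * ‖z‖ ^ 2) ^ n / (Nat.factorial n : ℝ) = 2 ^ n * (‖z‖ ^ n / s) ^ 2 := by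
    rw [← hs2, mul_pow, div_pow, ← pow_mul, ← pow_mul, mul_comm n 2]
    ring
  have hhalf : (1 / 2 : ℝ) ^ n * 2 ^ n = 1 := by rw [← mul_pow]; norm_num
  have hhalf_pos : (0 : ℝ) < (1 / 2) ^ n := by positivity
  rw [hnorm, hexp, ← sq_abs (a n)]
  set b := |a n|
  set y := ‖z‖ ^ n / s
  have hb : 0 ≤ b := abs_nonneg _
  have hy : 0 ≤ y := by positivity
  have hsq : 0 ≤ (1 / 2 : ℝ) ^ n * (b - 2 ^ n * y) ^ 2 := by positivity
  have hsq_eq : (1 / 2 : ℝ) ^ n * (b - 2 ^ n * y) ^ 2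
      = (1 / 2 : ℝ) ^ n * b ^ 2 + 2 ^ n * y ^ 2 - 2 * (b * y) := by
    linear_combination (2 ^ n * y ^ 2 - 2 * b * y) * hhalf
  linarith [mul_nonneg hb hy]

/-- **Random power series with Gaussian coefficients are a.s. entire.**
If each `ξ_n` is a standard normal random variable, then almost surely the power series
`∑ (ξ_n / √(n!)) zⁿ` converges absolutely for every `z ∈ ℂ`, i.e. it has infinite radius
of convergence and defines an entire function. -/
theorem gaussian_power_series_entire
    {Ω : Type*} [MeasurableSpace Ω] (P : Measure Ω) [IsProbabilityMeasure P]
    (ξ : ℕ → Ω → ℝ) (hmeas : ∀ n, Measurable (ξ n))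
    (hlaw : ∀ n, Measure.map (ξ n) P = gaussianReal 0 1) :
    ∀ᵐ ω ∂P, ∀ z : ℂ,
      Summable fun n : ℕ =>
        ‖((ξ n ω : ℂ) / (Real.sqrt (Nat.factorial n : ℝ) : ℂ)) * z ^ n‖ := by
  have hsq : Measurable fun x : ℝ ↦ x ^ 2 := by fun_prop
  have hmap (n : ℕ) : P.map (fun ω ↦ ξ n ω ^ 2) = (gaussianReal 0 1).map (fun x ↦ x ^ 2) := by
    rw [← hlaw n, Measure.map_map hsq (hmeas n)]
    rfl
  have hint : ∫⁻ x, ‖x‖ₑ ∂((gaussianReal 0 1).map (fun x ↦ x ^ 2)) ≠ ⊤ := by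
    rw [lintegral_map measurable_enorm hsq]
    exact (memLp_id_gaussianReal (μ := 0) (v := 1) 2).integrable_sq.hasFiniteIntegral.ne
  filter_upwards [ae_summable_mul_norm_of_map_eq (fun n ↦ (hmeas n).pow_const 2) hmap hint
    summable_geometric_two (fun n ↦ by positivity)] with ω hω z
  exact summable_norm_div_sqrt_factorial_mul_pow (by simpa using hω) z
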